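/- Let Ω ⊂ ℝ^d be a nonempty bounded open set, let E be a dyadic function on Ω that is positive and regular, let ω ⊂ Ω be open and H ∈ ℝ. If {x ∈ ω : h_E(x) = H} is nonempty, then dim_H{x ∈ ω : h_E(x) = H} ≤ sup_{x∈ω} inf_{p∈ℝ} (H·p − τ_E(x,p)), the supremum and infimum being taken in the extended reals [−∞,+∞]. -/

import Mathlib

open MeasureTheory Filter Metric Set
open scoped ENNReal Topology

noncomputable section

/-- The dyadic cube of scale `j` with index `k`:
`λ = ∏_i [k_i 2^{-j}, (k_i+1) 2^{-j})`. -/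
def dyadicCube (d : ℕ) (j : ℕ) (k : Fin d → ℤ) : Set (Fin d → ℝ) :=
  {y | ∀ i, (k i : ℝ) * 2 ^ (-(j : ℤ)) ≤ y i ∧ y i < ((k i : ℝ) + 1) * 2 ^ (-(j : ℤ))}

/-- The index of the unique dyadic cube of scale `j` containing `x`. -/
def dyadicIndex (d : ℕ) (j : ℕ) (x : Fin d → ℝ) : Fin d → ℤ :=
  fun i => ⌊x i * 2 ^ (j : ℕ)⌋

/-- The lower exponent of a dyadic function `e` at `x`:
`h_E(x) = liminf_{j→∞} log e_{λ_j(x)} / log 2^{-j}`, taken in `[-∞,∞]` with the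
convention `log 0 = -∞` (so that the quotient by the negative quantity `log 2^{-j}`
is `+∞` when `e_{λ_j(x)} = 0`). -/
def lowerExp {d : ℕ} (e : ℕ → (Fin d → ℤ) → ℝ) (x : Fin d → ℝ) : EReal :=
  Filter.liminf
    (fun j : ℕ =>
      if e j (dyadicIndex d j x) = 0 then (⊤ : EReal)
      else ((Real.log (e j (dyadicIndex d j x)) / Real.log ((2 : ℝ) ^ (-(j : ℤ))) : ℝ) : EReal))
    Filter.atTop

/-- The structure function `S_j(ω,p) = Σ_{λ ⊆ ω, ⟨λ⟩ = j} (e_λ)^p` of a dyadic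
function `e` on `ω` (a finite sum when `ω` is bounded). -/
def structFn {d : ℕ} (e : ℕ → (Fin d → ℤ) → ℝ) (ω : Set (Fin d → ℝ)) (j : ℕ) (p : ℝ) : ℝ :=
  ∑ᶠ k ∈ {k : Fin d → ℤ | dyadicCube d j k ⊆ ω}, e j k ^ p

/-- The scaling function `τ_E^ω(p) = liminf_{j→∞} log S_j(ω,p) / log 2^{-j}`. -/
def scalingFn {d : ℕ} (e : ℕ → (Fin d → ℤ) → ℝ) (ω : Set (Fin d → ℝ)) (p : ℝ) : ℝ :=
  Filter.liminf
    (fun j : ℕ => Real.log (structFn e ω j p) / Real.log ((2 : ℝ) ^ (-(j : ℤ))))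
    Filter.atTop

/-- The local scaling function `τ_E(x,p) = lim_{r→0⁺} τ_E^{B(x,r)∩Ω}(p)`; since
`r ↦ τ_E^{B(x,r)∩Ω}(p)` is nonincreasing in `r`, the limit equals the supremum
over `r > 0`. -/
def locScalingFn {d : ℕ} (e : ℕ → (Fin d → ℤ) → ℝ) (Ω : Set (Fin d → ℝ))
    (x : Fin d → ℝ) (p : ℝ) : ℝ :=
  ⨆ r : {r : ℝ // 0 < r}, scalingFn e (Metric.ball x r.1 ∩ Ω) p

/-- The local multifractal spectrum
`d_E(x,H) = lim_{r→0⁺} dim_H {y ∈ B(x,r) ∩ Ω : h_E(y) = H}`; since the spectrum on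
`B(x,r) ∩ Ω` is nondecreasing in `r`, the limit equals the infimum over `r > 0`. -/
def locSpectrum {d : ℕ} (e : ℕ → (Fin d → ℤ) → ℝ) (Ω : Set (Fin d → ℝ))
    (x : Fin d → ℝ) (H : ℝ) : ℝ≥0∞ :=
  ⨅ (r : ℝ) (_ : 0 < r),
    dimH {y ∈ Metric.ball x r ∩ Ω | lowerExp e y = (H : EReal)}

/-- The dyadic function `e` is positive and regular on `Ω`: every `e_λ` with `λ ⊆ Ω`
is positive, and `C₁ 2^{-Bj} ≤ e_λ ≤ C₂ 2^{-Aj}` for all dyadic `λ ⊆ Ω` of scale `j`. -/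
def PositiveRegular {d : ℕ} (e : ℕ → (Fin d → ℤ) → ℝ) (Ω : Set (Fin d → ℝ)) : Prop :=
  (∀ j k, dyadicCube d j k ⊆ Ω → 0 < e j k) ∧
  ∃ C₁ C₂ A B : ℝ, 0 < C₁ ∧ 0 < C₂ ∧
    ∀ j k, dyadicCube d j k ⊆ Ω →
      C₁ * 2 ^ (-(B * j)) ≤ e j k ∧ e j k ≤ C₂ * 2 ^ (-(A * j))

theorem corner_mem_dyadicCube (d j : ℕ) (k : Fin d → ℤ) :
    (fun i => (k i : ℝ) * 2 ^ (-(j : ℤ))) ∈ dyadicCube d j k := fun i =>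
  ⟨le_rfl, mul_lt_mul_of_pos_right (lt_add_one _) (by positivity)⟩

theorem mem_dyadicCube_dyadicIndex (d j : ℕ) (x : Fin d → ℝ) :
    x ∈ dyadicCube d j (dyadicIndex d j x) := by
  intro i
  have h : (0 : ℝ) < 2 ^ j := by positivity
  rw [zpow_neg, zpow_natCast, ← div_eq_mul_inv, ← div_eq_mul_inv, div_le_iff₀ h, lt_div_iff₀ h]
  exact ⟨Int.floor_le _, Int.lt_floor_add_one _⟩

theorem dist_le_of_mem_dyadicCube {d j : ℕ} {k : Fin d → ℤ} {x y : Fin d → ℝ}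
    (hx : x ∈ dyadicCube d j k) (hy : y ∈ dyadicCube d j k) :
    dist x y ≤ 2 ^ (-(j : ℤ)) := by
  refine (dist_pi_le_iff (by positivity)).2 fun i => ?_
  have h₁ := hx i
  have h₂ := hy i
  rw [Real.dist_eq, abs_le]
  constructor <;> linarith

theorem ediam_dyadicCube_le (d j : ℕ) (k : Fin d → ℤ) :
    ediam (dyadicCube d j k) ≤ ENNReal.ofReal (2 ^ (-(j : ℤ))) :=
  ediam_le fun x hx y hy => by
    rw [edist_dist]
    exact ENNReal.ofReal_le_ofReal (dist_le_of_mem_dyadicCube hx hy)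

theorem tendsto_two_zpow_neg : Tendsto (fun j : ℕ => (2 : ℝ) ^ (-(j : ℤ))) atTop (𝓝 0) := by
  simp only [zpow_neg, zpow_natCast, ← inv_pow]
  exact tendsto_pow_atTop_nhds_zero_of_lt_one (by norm_num) (by norm_num)

theorem eventually_dyadicCube_subset {d : ℕ} {U : Set (Fin d → ℝ)} (hU : IsOpen U)
    {x : Fin d → ℝ} (hx : x ∈ U) :
    ∀ᶠ j : ℕ in atTop, dyadicCube d j (dyadicIndex d j x) ⊆ U := by
  obtain ⟨r, hr, hrU⟩ := Metric.isOpen_iff.1 hU x hx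
  filter_upwards [tendsto_two_zpow_neg.eventually_lt_const hr] with j hj y hy
  exact hrU (mem_ball.2
    ((dist_le_of_mem_dyadicCube hy (mem_dyadicCube_dyadicIndex d j x)).trans_lt hj))

/-- A set covered infinitely often by at most `2 ^ (j (c - η))` dyadic cubes of scale `j`
has Hausdorff dimension at most `c`. -/
theorem dimH_le_of_frequently_mem_dyadicCube {d : ℕ} {S : Set (Fin d → ℝ)} {c η : ℝ}
    (hη : 0 < η) (hc : 0 ≤ c) (G : ℕ → Finset (Fin d → ℤ))
    (hG : ∀ᶠ j : ℕ in atTop, ((G j).card : ℝ) ≤ 2 ^ ((j : ℝ) * (c - η)))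
    (hS : ∀ x ∈ S, ∃ᶠ j in atTop, ∃ k ∈ G j, x ∈ dyadicCube d j k) :
    dimH S ≤ ENNReal.ofReal c := by
  refine dimH_le_of_hausdorffMeasure_ne_top (d := c.toNNReal) ?_
  rw [Real.coe_toNNReal c hc]
  set q : ℝ≥0∞ := ENNReal.ofReal ((2 : ℝ) ^ (-η)) with hq
  have hq1 : q < 1 := by
    rw [hq, ENNReal.ofReal_lt_one]
    exact Real.rpow_lt_one_of_one_lt_of_neg one_lt_two (by linarith)
  have hscale : ∀ {j : ℕ}, ((G j).card : ℝ) ≤ 2 ^ ((j : ℝ) * (c - η)) →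
      ∑' k : {k // k ∈ G j}, ediam (dyadicCube d j k) ^ c ≤ q ^ j := by
    intro j hj
    calc ∑' k : {k // k ∈ G j}, ediam (dyadicCube d j k) ^ c
        ≤ ∑' _ : {k // k ∈ G j}, ENNReal.ofReal (2 ^ (-(j : ℤ))) ^ c :=
          ENNReal.tsum_le_tsum fun k =>
            ENNReal.rpow_le_rpow (ediam_dyadicCube_le d j k) hc
      _ = ENNReal.ofReal ((G j).card * (2 : ℝ) ^ (-((j : ℝ) * c))) := by
          rw [tsum_fintype, Finset.sum_const, Finset.card_univ, Fintype.card_coe, nsmul_eq_mul,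
            ENNReal.ofReal_mul (by positivity), ENNReal.ofReal_natCast,
            ENNReal.ofReal_rpow_of_pos (by positivity), ← Real.rpow_intCast,
            ← Real.rpow_mul (by norm_num)]
          push_cast
          rw [neg_mul]
      _ ≤ ENNReal.ofReal ((2 : ℝ) ^ ((j : ℝ) * (c - η)) * (2 : ℝ) ^ (-((j : ℝ) * c))) := by
          gcongr
      _ = q ^ j := by
          rw [hq, ← ENNReal.ofReal_pow (by positivity), ← Real.rpow_add (by norm_num),
            ← Real.rpow_natCast, ← Real.rpow_mul (by norm_num)]
          ring_nf
  have hle := Measure.hausdorffMeasure_le_liminf_tsum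
    (ι := fun n : ℕ => Σ m : ℕ, {k // k ∈ G (n + m)}) c S (l := atTop)
    (fun n => ENNReal.ofReal (2 ^ (-(n : ℤ))))
    (by simpa using ENNReal.tendsto_ofReal tendsto_two_zpow_neg)
    (fun n i => dyadicCube d (n + i.1) i.2)
    (Eventually.of_forall fun n i => (ediam_dyadicCube_le _ _ _).trans
      (ENNReal.ofReal_le_ofReal (zpow_le_zpow_right₀ (by norm_num) (by push_cast; omega))))
    (Eventually.of_forall fun n x hx => by
      obtain ⟨j, hj, k, hk, hxk⟩ := frequently_atTop.1 (hS x hx) n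
      obtain ⟨m, rfl⟩ := Nat.exists_eq_add_of_le hj
      exact mem_iUnion.2 ⟨⟨m, k, hk⟩, hxk⟩)
  refine ne_top_of_le_ne_top (b := (1 - q)⁻¹) ?_ (hle.trans ?_)
  · exact ENNReal.inv_ne_top.2 (tsub_pos_of_lt hq1).ne'
  refine liminf_le_of_frequently_le' (Eventually.frequently ?_)
  filter_upwards [eventually_forall_ge_atTop.2 hG] with n hn
  rw [ENNReal.tsum_sigma', ← ENNReal.tsum_geometric]
  refine ENNReal.tsum_le_tsum fun m => (hscale (hn (n + m) (Nat.le_add_right n m))).trans ?_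
  exact pow_le_pow_right_of_le_one' hq1.le (Nat.le_add_left m n)

/-- Every dyadic cube of scale `j` inside a bounded set has its index in a box of side
comparable to `2 ^ j`. -/
theorem exists_dyadicCube_index_mem_piFinset {d : ℕ} {Ω : Set (Fin d → ℝ)}
    (hΩ : Bornology.IsBounded Ω) :
    ∃ R : ℕ, ∀ (j : ℕ) (k : Fin d → ℤ), dyadicCube d j k ⊆ Ω →
      k ∈ Fintype.piFinset fun _ : Fin d => Finset.Icc (-((R : ℤ) * 2 ^ j)) (R * 2 ^ j) := by
  obtain ⟨r, hr⟩ := hΩ.subset_closedBall 0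
  refine ⟨⌈r⌉₊, fun j k hk => Fintype.mem_piFinset.2 fun i => ?_⟩
  have h := mem_closedBall_zero_iff.1 (hr (hk (corner_mem_dyadicCube d j k)))
  have hi := ((norm_le_pi_norm _ i).trans h).trans (Nat.le_ceil r)
  have h2 : (0 : ℝ) < 2 ^ j := by positivity
  rw [Real.norm_eq_abs, zpow_neg, zpow_natCast, ← div_eq_mul_inv, abs_div, abs_of_pos h2,
    div_le_iff₀ h2, abs_le] at hi
  rw [Finset.mem_Icc]
  exact_mod_cast hi

theorem finite_setOf_dyadicCube_subset {d : ℕ} {U : Set (Fin d → ℝ)}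
    (hU : Bornology.IsBounded U) (j : ℕ) : {k : Fin d → ℤ | dyadicCube d j k ⊆ U}.Finite := by
  obtain ⟨R, hR⟩ := exists_dyadicCube_index_mem_piFinset hU
  exact (Finset.finite_toSet _).subset fun k hk => hR j k hk

theorem PositiveRegular.exists_abs_log_le {d : ℕ} {e : ℕ → (Fin d → ℤ) → ℝ}
    {Ω : Set (Fin d → ℝ)} (h : PositiveRegular e Ω) :
    ∃ L : ℝ, 0 ≤ L ∧ ∀ j k, dyadicCube d j k ⊆ Ω → |Real.log (e j k)| ≤ L * (j + 1) := by
  obtain ⟨hpos, C₁, C₂, A, B, hC₁, hC₂, hbd⟩ := h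
  have hlog2 : 0 < Real.log 2 := Real.log_pos one_lt_two
  refine ⟨|Real.log C₁| + |Real.log C₂| + |A| * Real.log 2 + |B| * Real.log 2, by positivity,
    fun j k hk => ?_⟩
  obtain ⟨hl, hu⟩ := hbd j k hk
  have hl' := Real.log_le_log (by positivity) hl
  have hu' := Real.log_le_log (hpos j k hk) hu
  rw [Real.log_mul (by positivity) (by positivity), Real.log_rpow two_pos] at hl' hu'
  have hj : (0 : ℝ) ≤ j := j.cast_nonneg
  have hjl : 0 ≤ j * Real.log 2 := by positivity
  have a1 := neg_abs_le (Real.log C₁)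
  have a2 := le_abs_self (Real.log C₂)
  have a3 := mul_le_mul_of_nonneg_right (neg_abs_le A) hjl
  have a4 := mul_le_mul_of_nonneg_right (le_abs_self B) hjl
  have b1 := mul_nonneg (abs_nonneg (Real.log C₁)) hj
  have b2 := mul_nonneg (abs_nonneg (Real.log C₂)) hj
  have b3 := mul_nonneg (abs_nonneg A) hlog2.le
  have b4 := mul_nonneg (abs_nonneg B) hlog2.le
  have b5 := mul_nonneg (abs_nonneg A) hjl
  have b6 := mul_nonneg (abs_nonneg B) hjl
  have c1 := abs_nonneg (Real.log C₁)
  have c2 := abs_nonneg (Real.log C₂)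
  rw [abs_le]
  constructor <;> nlinarith

theorem structFn_eq_sum {d : ℕ} (e : ℕ → (Fin d → ℤ) → ℝ) {U : Set (Fin d → ℝ)}
    (hU : Bornology.IsBounded U) (j : ℕ) (p : ℝ) :
    structFn e U j p = ∑ k ∈ (finite_setOf_dyadicCube_subset hU j).toFinset, e j k ^ p :=
  finsum_mem_eq_finite_toFinset_sum _ _

theorem card_le_structFn {d : ℕ} {e : ℕ → (Fin d → ℤ) → ℝ} {U : Set (Fin d → ℝ)}
    (hU : Bornology.IsBounded U) {j : ℕ} {p : ℝ}
    (hpos : ∀ k, dyadicCube d j k ⊆ U → 0 < e j k) {a : ℝ} {G : Finset (Fin d → ℤ)}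
    (hG : ∀ k ∈ G, dyadicCube d j k ⊆ U ∧ a ≤ e j k ^ p) :
    G.card * a ≤ structFn e U j p := by
  rw [structFn_eq_sum e hU, ← nsmul_eq_mul, ← Finset.sum_const]
  calc ∑ _k ∈ G, a ≤ ∑ k ∈ G, e j k ^ p := Finset.sum_le_sum fun k hk => (hG k hk).2
    _ ≤ _ := Finset.sum_le_sum_of_subset_of_nonneg
      (fun k hk => (Set.Finite.mem_toFinset _).2 (hG k hk).1)
      fun k hk _ => Real.rpow_nonneg (hpos k ((Set.Finite.mem_toFinset _).1 hk)).le _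

/-- The quotients defining the scaling function are bounded, uniformly over all subsets
and all scales. -/
theorem PositiveRegular.exists_abs_log_structFn_div_le {d : ℕ} {e : ℕ → (Fin d → ℤ) → ℝ}
    {Ω : Set (Fin d → ℝ)} (h : PositiveRegular e Ω) (hΩ : Bornology.IsBounded Ω) (p : ℝ) :
    ∃ K : ℝ, ∀ U ⊆ Ω, ∀ j : ℕ,
      |Real.log (structFn e U j p) / Real.log ((2 : ℝ) ^ (-(j : ℤ)))| ≤ K := by
  obtain ⟨L, hL, hlog⟩ := h.exists_abs_log_le
  obtain ⟨R, hR⟩ := exists_dyadicCube_index_mem_piFinset hΩ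
  have hlog2 : 0 < Real.log 2 := Real.log_pos one_lt_two
  set D : ℝ := d * (Real.log (2 * R + 1) + Real.log 2)
  have hR1 : 0 ≤ Real.log (2 * (R : ℝ) + 1) := Real.log_nonneg (by
    have : (0 : ℝ) ≤ R := R.cast_nonneg
    linarith)
  have hD : 0 ≤ D := by positivity
  have key : ∀ U ⊆ Ω, ∀ j : ℕ, |Real.log (structFn e U j p)| ≤ (D + |p| * L) * (j + 1) := by
    intro U hU j
    have hUb := hΩ.subset hU
    have hj : (0 : ℝ) ≤ j := j.cast_nonneg
    rcases {k : Fin d → ℤ | dyadicCube d j k ⊆ U}.eq_empty_or_nonempty with hemp | ⟨k₀, hk₀⟩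
    · rw [structFn, hemp, finsum_mem_empty, Real.log_zero, abs_zero]
      positivity
    have hterm : ∀ k, dyadicCube d j k ⊆ U → Real.exp (-(|p| * L * (j + 1))) ≤ e j k ^ p ∧
        e j k ^ p ≤ Real.exp (|p| * L * (j + 1)) := by
      intro k hk
      have hpos := h.1 j k (hk.trans hU)
      have hab : |Real.log (e j k) * p| ≤ |p| * L * (j + 1) := by
        rw [abs_mul, mul_comm, mul_assoc]
        exact mul_le_mul_of_nonneg_left (hlog j k (hk.trans hU)) (abs_nonneg p)
      rw [Real.rpow_def_of_pos hpos, Real.exp_le_exp, Real.exp_le_exp]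
      exact abs_le.1 hab
    have hlow : Real.exp (-(|p| * L * (j + 1))) ≤ structFn e U j p := by
      have := card_le_structFn (e := e) (p := p) hUb (fun k hk => h.1 j k (hk.trans hU))
        (a := Real.exp (-(|p| * L * (j + 1)))) (G := {k₀}) (fun k hk => by
          obtain rfl := Finset.mem_singleton.1 hk
          exact ⟨hk₀, (hterm k hk₀).1⟩)
      simpa using this
    have hpos : 0 < structFn e U j p := (Real.exp_pos _).trans_le hlow
    have hcard : ((finite_setOf_dyadicCube_subset hUb j).toFinset.card : ℝ)
        ≤ ((2 * R + 1) * 2 ^ j) ^ d := by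
      have h1 := Finset.card_le_card (s := (finite_setOf_dyadicCube_subset hUb j).toFinset)
        (fun k hk => hR j k (((Set.Finite.mem_toFinset _).1 hk).trans hU))
      rw [Fintype.card_piFinset_const, Int.card_Icc] at h1
      refine (Nat.cast_le.2 h1).trans ?_
      push_cast
      refine pow_le_pow_left₀ (Nat.cast_nonneg _) ?_ _
      have h3 : ((R : ℤ) * 2 ^ j + 1 - -((R : ℤ) * 2 ^ j)).toNat = 2 * (R * 2 ^ j) + 1 := by
        have : ((R : ℤ) * 2 ^ j) = ((R * 2 ^ j : ℕ) : ℤ) := by push_cast; rfl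
        omega
      rw [h3]
      push_cast
      nlinarith [one_le_pow₀ (n := j) (one_le_two : (1 : ℝ) ≤ 2)]
    have hup : structFn e U j p ≤ ((2 * R + 1) * 2 ^ j) ^ d * Real.exp (|p| * L * (j + 1)) := by
      rw [structFn_eq_sum e hUb]
      refine (Finset.sum_le_card_nsmul _ _ _ fun k hk =>
        (hterm k ((Set.Finite.mem_toFinset _).1 hk)).2).trans ?_
      rw [nsmul_eq_mul]
      exact mul_le_mul_of_nonneg_right hcard (Real.exp_pos _).le
    have hl1 := Real.log_le_log (Real.exp_pos _) hlow
    have hl2 := Real.log_le_log hpos hup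
    rw [Real.log_exp] at hl1
    rw [Real.log_mul (by positivity) (by positivity), Real.log_exp, Real.log_pow,
      Real.log_mul (by positivity) (by positivity), Real.log_pow] at hl2
    have hDj : d * (Real.log (2 * R + 1) + j * Real.log 2) ≤ D * (j + 1) := by
      have : (Real.log (2 * R + 1) + j * Real.log 2)
          ≤ (Real.log (2 * R + 1) + Real.log 2) * (j + 1) := by
        nlinarith [mul_nonneg hR1 hj]
      calc _ ≤ d * ((Real.log (2 * R + 1) + Real.log 2) * (j + 1)) := by gcongr
        _ = _ := by ring
    have hDp : 0 ≤ D * (j + 1) := by positivity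
    rw [abs_le]
    constructor <;> linarith
  refine ⟨2 * (D + |p| * L) / Real.log 2, fun U hU j => ?_⟩
  rcases Nat.eq_zero_or_pos j with rfl | hj
  · simp only [Nat.cast_zero, neg_zero, zpow_zero, Real.log_one, div_zero, abs_zero]
    positivity
  have hj1 : (1 : ℝ) ≤ j := by exact_mod_cast hj
  rw [Real.log_zpow, abs_div, abs_mul, abs_of_pos hlog2]
  push_cast
  rw [abs_neg, Nat.abs_cast, div_le_div_iff₀ (by positivity) hlog2]
  calc |Real.log (structFn e U j p)| * Real.log 2
      ≤ (D + |p| * L) * (j + 1) * Real.log 2 := by gcongr; exact key U hU j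
    _ ≤ (D + |p| * L) * (2 * j) * Real.log 2 := by gcongr; linarith
    _ = _ := by ring

theorem PositiveRegular.bddAbove_range_scalingFn {d : ℕ} {e : ℕ → (Fin d → ℤ) → ℝ}
    {Ω : Set (Fin d → ℝ)} (h : PositiveRegular e Ω) (hΩ : Bornology.IsBounded Ω)
    (x : Fin d → ℝ) (p : ℝ) :
    BddAbove (range fun r : {r : ℝ // 0 < r} => scalingFn e (ball x r.1 ∩ Ω) p) := by
  obtain ⟨K, hK⟩ := h.exists_abs_log_structFn_div_le hΩ p
  refine ⟨K, ?_⟩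
  rintro _ ⟨r, rfl⟩
  have hb := hK (ball x r.1 ∩ Ω) inter_subset_right
  exact liminf_le_of_frequently_le (Frequently.of_forall fun j => (abs_le.1 (hb j)).2)
    (isBoundedUnder_of ⟨-K, fun j => (abs_le.1 (hb j)).1⟩)

theorem PositiveRegular.eventually_structFn_le {d : ℕ} {e : ℕ → (Fin d → ℤ) → ℝ}
    {Ω U : Set (Fin d → ℝ)} (h : PositiveRegular e Ω) (hΩ : Bornology.IsBounded Ω) (hU : U ⊆ Ω)
    {p t : ℝ} (ht : t < scalingFn e U p) :
    ∀ᶠ j : ℕ in atTop, structFn e U j p ≤ 2 ^ (-((j : ℝ) * t)) := by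
  obtain ⟨K, hK⟩ := h.exists_abs_log_structFn_div_le hΩ p
  have hlog2 : 0 < Real.log 2 := Real.log_pos one_lt_two
  filter_upwards [eventually_lt_of_lt_liminf ht
    (isBoundedUnder_of ⟨-K, fun j => (abs_le.1 (hK U hU j)).1⟩), eventually_gt_atTop 0]
    with j hj hj0
  rcases le_or_gt (structFn e U j p) 0 with h0 | h0
  · exact h0.trans (by positivity)
  have hj0' : (0 : ℝ) < j := by exact_mod_cast hj0
  rw [Real.log_zpow] at hj
  push_cast at hj
  rw [lt_div_iff_of_neg (by nlinarith)] at hj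
  rw [Real.le_rpow_iff_log_le h0 two_pos]
  linarith

/-- At a point where the lower exponent is `H`, infinitely many of the containing cubes have
`e_λ ^ p` at least `2 ^ (-j (H p + η))`. -/
theorem frequently_le_rpow_of_lowerExp_eq {d : ℕ} {e : ℕ → (Fin d → ℤ) → ℝ}
    {U : Set (Fin d → ℝ)} (hU : IsOpen U) (hpos : ∀ j k, dyadicCube d j k ⊆ U → 0 < e j k)
    {x : Fin d → ℝ} (hx : x ∈ U) {H : ℝ} (hH : lowerExp e x = H) (p : ℝ) {η : ℝ}
    (hη : 0 < η) :
    ∃ᶠ j : ℕ in atTop, dyadicCube d j (dyadicIndex d j x) ⊆ U ∧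
      2 ^ (-((j : ℝ) * (H * p + η))) ≤ e j (dyadicIndex d j x) ^ p := by
  set ε : ℝ := η / (|p| + 1) with hε
  have hp1 : 0 < |p| + 1 := by positivity
  have hε0 : 0 < ε := by positivity
  have hlog2 : 0 < Real.log 2 := Real.log_pos one_lt_two
  have hlow : ((H - ε : ℝ) : EReal) < lowerExp e x := by
    rw [hH]
    exact_mod_cast sub_lt_self H hε0
  have hhigh : lowerExp e x < ((H + ε : ℝ) : EReal) := by
    rw [hH]
    exact_mod_cast lt_add_of_pos_right H hε0
  refine ((frequently_lt_of_liminf_lt (by isBoundedDefault) hhigh).and_eventually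
    ((eventually_lt_of_lt_liminf hlow).and ((eventually_dyadicCube_subset hU hx).and
      (eventually_gt_atTop 0)))).mono ?_
  rintro j ⟨hup, hlo, hsub, hj0⟩
  have he := hpos j _ hsub
  refine ⟨hsub, ?_⟩
  rw [if_neg he.ne', EReal.coe_lt_coe_iff] at hup hlo
  set a := Real.log (e j (dyadicIndex d j x)) / Real.log ((2 : ℝ) ^ (-(j : ℤ))) with ha
  have hj0' : (0 : ℝ) < j := by exact_mod_cast hj0
  have hlog : Real.log (e j (dyadicIndex d j x)) = -((j : ℝ) * Real.log 2) * a := by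
    rw [ha, Real.log_zpow]
    push_cast
    field_simp
  have hpa : (a - H) * p ≤ η := by
    calc (a - H) * p ≤ |a - H| * |p| := (le_abs_self _).trans (abs_mul _ _).le
      _ ≤ ε * (|p| + 1) := by
        gcongr
        · exact abs_le.2 ⟨by linarith, by linarith⟩
        · linarith
      _ = η := div_mul_cancel₀ _ hp1.ne'
  rw [Real.rpow_def_of_pos he, Real.rpow_def_of_pos two_pos, Real.exp_le_exp, hlog]
  have : 0 < (j : ℝ) * Real.log 2 := by positivity
  nlinarith [mul_le_mul_of_nonneg_left hpa this.le]

/-- The Legendre upper bound on an open set, for a single exponent `p`. -/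
theorem PositiveRegular.dimH_le_of_scalingFn {d : ℕ} {e : ℕ → (Fin d → ℤ) → ℝ}
    {Ω U : Set (Fin d → ℝ)} (h : PositiveRegular e Ω) (hΩ : Bornology.IsBounded Ω)
    (hUo : IsOpen U) (hU : U ⊆ Ω) {H p c : ℝ} (hc : H * p - scalingFn e U p < c)
    (hne : {x ∈ U | lowerExp e x = (H : EReal)}.Nonempty) :
    0 ≤ c ∧ dimH {x ∈ U | lowerExp e x = (H : EReal)} ≤ ENNReal.ofReal c := by
  classical
  set η : ℝ := (c - (H * p - scalingFn e U p)) / 3 with hη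
  have hη0 : 0 < η := by linarith [div_pos (sub_pos.2 hc) three_pos]
  have hUb := hΩ.subset hU
  have hpos : ∀ j k, dyadicCube d j k ⊆ U → 0 < e j k := fun j k hk => h.1 j k (hk.trans hU)
  let G : ℕ → Finset (Fin d → ℤ) := fun j =>
    (finite_setOf_dyadicCube_subset hUb j).toFinset.filter
      fun k => (2 : ℝ) ^ (-((j : ℝ) * (H * p + η))) ≤ e j k ^ p
  have hmem : ∀ j k, k ∈ G j ↔ dyadicCube d j k ⊆ U ∧
      (2 : ℝ) ^ (-((j : ℝ) * (H * p + η))) ≤ e j k ^ p := by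
    simp [G]
  have hG : ∀ᶠ j : ℕ in atTop, ((G j).card : ℝ) ≤ 2 ^ ((j : ℝ) * (c - η)) := by
    filter_upwards [h.eventually_structFn_le hΩ hU (sub_lt_self (scalingFn e U p) hη0)] with j hj
    have hcard := (card_le_structFn hUb (hpos j) fun k hk => (hmem j k).1 hk).trans hj
    rw [Real.rpow_neg two_pos.le, ← div_eq_mul_inv, div_le_iff₀ (by positivity),
      ← Real.rpow_add two_pos] at hcard
    refine hcard.trans_eq (congrArg _ ?_)
    rw [hη]
    ring
  have hS : ∀ x ∈ {x ∈ U | lowerExp e x = (H : EReal)},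
      ∃ᶠ j in atTop, ∃ k ∈ G j, x ∈ dyadicCube d j k := fun x hx =>
    (frequently_le_rpow_of_lowerExp_eq hUo hpos hx.1 hx.2 p hη0).mono fun j hj =>
      ⟨_, (hmem j _).2 hj, mem_dyadicCube_dyadicIndex d j x⟩
  have hc0 : 0 ≤ c := by
    obtain ⟨x, hx⟩ := hne
    obtain ⟨j, ⟨k, hk, -⟩, hj, hj0⟩ :=
      ((hS x hx).and_eventually (hG.and (eventually_gt_atTop 0))).exists
    have hone : (1 : ℝ) ≤ (G j).card := by exact_mod_cast Finset.card_pos.2 ⟨k, hk⟩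
    by_contra! hneg
    have hj0' : (0 : ℝ) < j := by exact_mod_cast hj0
    exact (hone.trans hj).not_gt
      (Real.rpow_lt_one_of_one_lt_of_neg one_lt_two
        (mul_neg_of_pos_of_neg hj0' (by linarith)))
  exact ⟨hc0, dimH_le_of_frequently_mem_dyadicCube hη0 hc0 G hG hS⟩

/-- Upper bound of the spectrum on an open subset via the local scaling function:
if `Ω` is a nonempty bounded open set, `E` is a positive regular dyadic function on
`Ω`, `ω ⊆ Ω` is open, `H ∈ ℝ`, and `{x ∈ ω : h_E(x) = H}` is nonempty, then
`dim_H {x ∈ ω : h_E(x) = H} ≤ sup_{x∈ω} inf_{p∈ℝ} (H p − τ_E(x,p))`,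
the supremum and infimum being taken in the extended reals. -/
theorem spectrum_le_iSup_iInf_local_legendre {d : ℕ} (Ω : Set (Fin d → ℝ))
    (hΩo : IsOpen Ω) (hΩne : Ω.Nonempty) (hΩb : Bornology.IsBounded Ω)
    (e : ℕ → (Fin d → ℤ) → ℝ) (hreg : PositiveRegular e Ω)
    (ω : Set (Fin d → ℝ)) (hωo : IsOpen ω) (hωΩ : ω ⊆ Ω) (H : ℝ)
    (hne : {x ∈ ω | lowerExp e x = (H : EReal)}.Nonempty) :
    (dimH {x ∈ ω | lowerExp e x = (H : EReal)} : EReal)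
      ≤ ⨆ x ∈ ω, ⨅ p : ℝ, ((H * p - locScalingFn e Ω x p : ℝ) : EReal) := by
  refine EReal.le_of_forall_lt_iff_le.1 fun c hc => ?_
  have hloc : ∀ x ∈ {x ∈ ω | lowerExp e x = (H : EReal)}, ∃ r > 0, 0 ≤ c ∧
      dimH {y ∈ ball x r ∩ Ω | lowerExp e y = (H : EReal)} ≤ ENNReal.ofReal c := by
    intro x hx
    obtain ⟨p, hp⟩ := iInf_lt_iff.1 ((le_iSup₂ (f := fun x (_ : x ∈ ω) =>
      ⨅ p : ℝ, ((H * p - locScalingFn e Ω x p : ℝ) : EReal)) x hx.1).trans_lt hc)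
    rw [EReal.coe_lt_coe_iff] at hp
    have : Nonempty {r : ℝ // 0 < r} := ⟨⟨1, one_pos⟩⟩
    obtain ⟨r, hr⟩ := exists_lt_of_lt_ciSup
      (show H * p - c < locScalingFn e Ω x p by linarith)
    exact ⟨r.1, r.2, hreg.dimH_le_of_scalingFn hΩb (isOpen_ball.inter hΩo) inter_subset_right
      (p := p) (by linarith) ⟨x, ⟨mem_ball_self r.2, hωΩ hx.1⟩, hx.2⟩⟩
  obtain ⟨x₀, hx₀⟩ := hne
  obtain ⟨-, -, hc0, -⟩ := hloc x₀ hx₀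
  have hdim : dimH {x ∈ ω | lowerExp e x = (H : EReal)} ≤ ENNReal.ofReal c := by
    by_contra! hlt
    obtain ⟨x, hx, hxt⟩ := exists_mem_nhdsWithin_lt_dimH_of_lt_dimH hlt
    obtain ⟨r, hr, -, hle⟩ := hloc x hx
    refine (hxt {y ∈ ball x r ∩ Ω | lowerExp e y = (H : EReal)} ?_).not_ge hle
    filter_upwards [mem_nhdsWithin_of_mem_nhds (ball_mem_nhds x hr), self_mem_nhdsWithin]
      with y hyr hyS
    exact ⟨⟨hyr, hωΩ hyS.1⟩, hyS.2⟩
  calc (dimH {x ∈ ω | lowerExp e x = (H : EReal)} : EReal)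
      ≤ (ENNReal.ofReal c : EReal) := EReal.coe_ennreal_le_coe_ennreal_iff.2 hdim
    _ = (c : EReal) := by rw [EReal.coe_ennreal_ofReal, max_eq_left hc0]

end
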